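/- Let ν > 0, T > 0, and let φ : ℝ² → ℝ be smooth and ℤ²-periodic. Suppose (ω, ψ) is a smooth, space-periodic solution of the inviscid 2D Euler equations (∂ω/∂t + ∇⊥ψ · ∇ω = 0, −Δψ = ω) on ℝ² × [0,T] with ω(·,0) = φ, and (ω_ν, ψ_ν) is a smooth, space-periodic solution of the 2D vorticity Navier–Stokes equations with viscosity ν (∂ω_ν/∂t + ∇⊥ψ_ν · ∇ω_ν = νΔω_ν, −Δψ_ν = ω_ν) on ℝ² × [0,T] with ω_ν(·,0) = φ. Then the enstrophy dissipation is bounded by the inviscid-limit discrepancy at the final time: (ν/T) ∫₀ᵀ ∫_{[0,1]²} |∇ω_ν(x,t)|² dx dt ≤ (2/T) ‖φ‖_{L²([0,1]²)} ‖ω(·,T) − ω_ν(·,T)‖_{L²([0,1]²)}. -/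

import Mathlib

open MeasureTheory Set

noncomputable section

/-- First spatial partial derivative ∂f/∂x₁. -/
def pd1 (f : ℝ × ℝ → ℝ) (x : ℝ × ℝ) : ℝ := fderiv ℝ f x (1, 0)

/-- Second spatial partial derivative ∂f/∂x₂. -/
def pd2 (f : ℝ × ℝ → ℝ) (x : ℝ × ℝ) : ℝ := fderiv ℝ f x (0, 1)

/-- Laplacian Δf = ∂²f/∂x₁² + ∂²f/∂x₂². -/
def lap (f : ℝ × ℝ → ℝ) (x : ℝ × ℝ) : ℝ := pd1 (pd1 f) x + pd2 (pd2 f) x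

/-- |∇f|². -/
def gradSq (f : ℝ × ℝ → ℝ) (x : ℝ × ℝ) : ℝ := (pd1 f x) ^ 2 + (pd2 f x) ^ 2

/-- ∇f · ∇g. -/
def gradDot (f g : ℝ × ℝ → ℝ) (x : ℝ × ℝ) : ℝ := pd1 f x * pd1 g x + pd2 f x * pd2 g x

/-- The advection term ∇⊥ψ · ∇ω, where ∇⊥ψ = (−∂ψ/∂x₂, ∂ψ/∂x₁). -/
def adv (ψ ω : ℝ × ℝ → ℝ) (x : ℝ × ℝ) : ℝ := (-(pd2 ψ x)) * pd1 ω x + pd1 ψ x * pd2 ω x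

/-- ℤ²-periodicity. -/
def Per (f : ℝ × ℝ → ℝ) : Prop := ∀ (x : ℝ × ℝ) (n m : ℤ), f (x.1 + (n : ℝ), x.2 + (m : ℝ)) = f x

/-- The fundamental domain [0,1]² of the torus 𝕋². -/
def Q : Set (ℝ × ℝ) := Icc (0:ℝ) 1 ×ˢ Icc (0:ℝ) 1

/-- Time slice of a time-dependent field: `sl f t = f(·, t)`. -/
def sl (f : ℝ × ℝ → ℝ → ℝ) (t : ℝ) : ℝ × ℝ → ℝ := fun x => f x t

/-- Joint smoothness on ℝ² × ℝ (representing smoothness on ℝ² × [0,T]). -/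
def SmoothST (f : ℝ × ℝ → ℝ → ℝ) : Prop :=
  ContDiff ℝ (⊤ : ℕ∞) (fun p : (ℝ × ℝ) × ℝ => f p.1 p.2)

/-- ℤ²-periodicity in the space variable at every time in [0,T]. -/
def PerST (T : ℝ) (f : ℝ × ℝ → ℝ → ℝ) : Prop := ∀ t ∈ Icc (0:ℝ) T, Per (sl f t)

/-- (ω, ψ) is a smooth, space-periodic solution of the 2D vorticity Navier–Stokes
equations with viscosity ν on ℝ² × [0,T]:
∂ω/∂t + ∇⊥ψ · ∇ω = νΔω and −Δψ = ω. -/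
def IsNSSol (ν T : ℝ) (ω ψ : ℝ × ℝ → ℝ → ℝ) : Prop :=
  SmoothST ω ∧ SmoothST ψ ∧ PerST T ω ∧ PerST T ψ ∧
  (∀ (x : ℝ × ℝ), ∀ t ∈ Icc (0:ℝ) T,
    deriv (fun s => ω x s) t + adv (sl ψ t) (sl ω t) x = ν * lap (sl ω t) x) ∧
  (∀ (x : ℝ × ℝ), ∀ t ∈ Icc (0:ℝ) T, -(lap (sl ψ t) x) = ω x t)

/-- (ω, ψ) is a smooth, space-periodic solution of the inviscid 2D Euler equations
in vorticity form on ℝ² × [0,T]: ∂ω/∂t + ∇⊥ψ · ∇ω = 0 and −Δψ = ω. -/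
def IsEulerSol (T : ℝ) (ω ψ : ℝ × ℝ → ℝ → ℝ) : Prop :=
  SmoothST ω ∧ SmoothST ψ ∧ PerST T ω ∧ PerST T ψ ∧
  (∀ (x : ℝ × ℝ), ∀ t ∈ Icc (0:ℝ) T,
    deriv (fun s => ω x s) t + adv (sl ψ t) (sl ω t) x = 0) ∧
  (∀ (x : ℝ × ℝ), ∀ t ∈ Icc (0:ℝ) T, -(lap (sl ψ t) x) = ω x t)

/-- Enstrophy E(t) = ½ ∫_{[0,1]²} |ω(x,t)|² dx. -/
def ens (ω : ℝ × ℝ → ℝ → ℝ) (t : ℝ) : ℝ := (1/2) * ∫ x in Q, (ω x t) ^ 2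

/-- Palinstrophy P(t) = ½ ∫_{[0,1]²} |∇ω(x,t)|² dx. -/
def pal (ω : ℝ × ℝ → ℝ → ℝ) (t : ℝ) : ℝ := (1/2) * ∫ x in Q, gradSq (sl ω t) x

lemma contDiff_pd1 {f : ℝ × ℝ → ℝ} (hf : ContDiff ℝ (⊤ : ℕ∞) f) :
    ContDiff ℝ (⊤ : ℕ∞) (pd1 f) :=
  (hf.fderiv_right (m := (⊤ : ℕ∞)) le_rfl).clm_apply contDiff_const

lemma contDiff_pd2 {f : ℝ × ℝ → ℝ} (hf : ContDiff ℝ (⊤ : ℕ∞) f) :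
    ContDiff ℝ (⊤ : ℕ∞) (pd2 f) :=
  (hf.fderiv_right (m := (⊤ : ℕ∞)) le_rfl).clm_apply contDiff_const

lemma Per.fderiv_eq {f : ℝ × ℝ → ℝ} (hp : Per f) (x : ℝ × ℝ) (n m : ℤ) :
    fderiv ℝ f (x.1 + (n : ℝ), x.2 + (m : ℝ)) = fderiv ℝ f x := by
  have h : (fun y => f (y + ((n : ℝ), (m : ℝ)))) = f := funext fun y => hp y n m
  have h2 := fderiv_comp_add_right (𝕜 := ℝ) (f := f) (x := x) ((n : ℝ), (m : ℝ))
  rw [h] at h2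
  exact h2.symm

lemma Per.pd1 {f : ℝ × ℝ → ℝ} (hp : Per f) : Per (pd1 f) := fun x n m => by
  simp only [_root_.pd1, hp.fderiv_eq x n m]

lemma Per.pd2 {f : ℝ × ℝ → ℝ} (hp : Per f) : Per (pd2 f) := fun x n m => by
  simp only [_root_.pd2, hp.fderiv_eq x n m]

/-- Mixed second partial derivatives of a smooth function commute. -/
lemma pd1_pd2_comm {f : ℝ × ℝ → ℝ} (hf : ContDiff ℝ (⊤ : ℕ∞) f) (x : ℝ × ℝ) :
    pd1 (pd2 f) x = pd2 (pd1 f) x := by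
  have hs : IsSymmSndFDerivAt ℝ f x :=
    hf.contDiffAt.isSymmSndFDerivAt (by simpa using WithTop.coe_le_coe.2 (le_top : (2 : ℕ∞) ≤ ⊤))
  have hd : DifferentiableAt ℝ (fderiv ℝ f) x :=
    ((hf.fderiv_right (m := (⊤ : ℕ∞)) le_rfl).differentiable (by simp)) x
  have key : ∀ v w : ℝ × ℝ, fderiv ℝ (fun y => fderiv ℝ f y v) x w
      = fderiv ℝ (fderiv ℝ f) x w v := fun v w => by
    rw [fderiv_clm_apply hd (differentiableAt_const v)]
    simp
  change fderiv ℝ (fun y => fderiv ℝ f y (0, 1)) x (1, 0)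
    = fderiv ℝ (fun y => fderiv ℝ f y (1, 0)) x (0, 1)
  rw [key, key]
  exact hs _ _

lemma isCompact_Q : IsCompact Q := isCompact_Icc.prod isCompact_Icc

lemma integrableOn_Q {f : ℝ × ℝ → ℝ} (hf : Continuous f) : IntegrableOn f Q :=
  hf.continuousOn.integrableOn_compact isCompact_Q

/-- The integral over the torus of the divergence of a periodic field vanishes. -/
lemma integral_div_eq_zero {F G : ℝ × ℝ → ℝ} (hF : ContDiff ℝ (⊤ : ℕ∞) F)
    (hG : ContDiff ℝ (⊤ : ℕ∞) G) (pF : Per F) (pG : Per G) :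
    ∫ x in Q, (pd1 F x + pd2 G x) = 0 := by
  have hQ : Q = Icc ((0 : ℝ), (0 : ℝ)) (1, 1) := Icc_prod_Icc 0 1 0 1
  have hcont : Continuous fun x => pd1 F x + pd2 G x :=
    (contDiff_pd1 hF).continuous.add (contDiff_pd2 hG).continuous
  have hint := integrableOn_Q hcont
  rw [hQ] at hint ⊢
  have h := integral_divergence_prod_Icc_of_hasFDerivAt_of_le F G (fderiv ℝ F) (fderiv ℝ G)
    ((0 : ℝ), (0 : ℝ)) (1, 1) (by simp [Prod.le_def]) hF.continuous.continuousOn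
    hG.continuous.continuousOn
    (fun x _ => (hF.differentiable (by simp) x).hasFDerivAt)
    (fun x _ => (hG.differentiable (by simp) x).hasFDerivAt) hint
  have e1 : ∀ y, F (1, y) = F (0, y) := fun y => by simpa using pF (0, y) 1 0
  have e2 : ∀ y, G (y, 1) = G (y, 0) := fun y => by simpa using pG (y, 0) 0 1
  simp only [e1, e2, sub_self, zero_add] at h
  exact h

/-- Spatial energy identity: advection by a divergence-free field drops out, and diffusion
dissipates. -/
lemma integral_mul_rhs {f g : ℝ × ℝ → ℝ} (hf : ContDiff ℝ (⊤ : ℕ∞) f)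
    (hg : ContDiff ℝ (⊤ : ℕ∞) g) (pf : Per f) (pg : Per g) (ν : ℝ) :
    ∫ x in Q, f x * (ν * lap f x - adv g f x) = -(ν * ∫ x in Q, gradSq f x) := by
  have f1 := contDiff_pd1 hf
  have f2 := contDiff_pd2 hf
  have g1 := contDiff_pd1 hg
  have g2 := contDiff_pd2 hg
  have hF : ContDiff ℝ (⊤ : ℕ∞) fun x => ν * (f x * pd1 f x) + 1 / 2 * (pd2 g x * f x ^ 2) := by
    fun_prop
  have hG : ContDiff ℝ (⊤ : ℕ∞) fun x => ν * (f x * pd2 f x) - 1 / 2 * (pd1 g x * f x ^ 2) := by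
    fun_prop
  have h0 := integral_div_eq_zero hF hG
    (fun x n m => by simp only [pf x n m, pf.pd1 x n m, pg.pd2 x n m])
    (fun x n m => by simp only [pf x n m, pf.pd2 x n m, pg.pd1 x n m])
  have D : ∀ {h : ℝ × ℝ → ℝ}, ContDiff ℝ (⊤ : ℕ∞) h → ∀ x, HasFDerivAt h (fderiv ℝ h x) x :=
    fun hh x => (hh.differentiable (by simp) x).hasFDerivAt
  have hpt : ∀ x, pd1 (fun x => ν * (f x * pd1 f x) + 1 / 2 * (pd2 g x * f x ^ 2)) x
      + pd2 (fun x => ν * (f x * pd2 f x) - 1 / 2 * (pd1 g x * f x ^ 2)) x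
      = f x * (ν * lap f x - adv g f x) + ν * gradSq f x := by
    intro x
    have d1 := ((((D hf x).mul (D f1 x)).const_mul ν).add
      ((((D g2 x).mul ((D hf x).pow 2))).const_mul (1 / 2))).fderiv
    have d2 := ((((D hf x).mul (D f2 x)).const_mul ν).sub
      ((((D g1 x).mul ((D hf x).pow 2))).const_mul (1 / 2))).fderiv
    have e1 := congrArg (fun L : ℝ × ℝ →L[ℝ] ℝ => L (1, 0)) d1
    have e2 := congrArg (fun L : ℝ × ℝ →L[ℝ] ℝ => L (0, 1)) d2
    have hc := pd1_pd2_comm hg x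
    refine (congrArg₂ (· + ·) e1 e2).trans ?_
    simp only [lap, adv, gradSq]
    simp only [pd1, pd2] at hc ⊢
    simp
    linear_combination (1 / 2 * f x ^ 2) * hc
  simp only [hpt] at h0
  have c1 : Continuous fun x => f x * (ν * lap f x - adv g f x) := by
    have := (contDiff_pd1 f1).continuous
    have := (contDiff_pd2 f2).continuous
    have := hf.continuous
    have := f1.continuous
    have := f2.continuous
    have := g1.continuous
    have := g2.continuous
    unfold lap adv
    fun_prop
  have c2 : Continuous fun x => ν * gradSq f x := by
    have := f1.continuous
    have := f2.continuous
    unfold gradSq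
    fun_prop
  rw [integral_add (integrableOn_Q c1) (integrableOn_Q c2), integral_const_mul] at h0
  linarith

lemma SmoothST.contDiff_sl {u : ℝ × ℝ → ℝ → ℝ} (hu : SmoothST u) (t : ℝ) :
    ContDiff ℝ (⊤ : ℕ∞) (sl u t) :=
  ContDiff.comp (g := fun p : (ℝ × ℝ) × ℝ => u p.1 p.2) (f := fun x => (x, t)) hu
    (contDiff_id.prodMk contDiff_const)

lemma SmoothST.hasDerivAt {u : ℝ × ℝ → ℝ → ℝ} (hu : SmoothST u) (x : ℝ × ℝ) (t : ℝ) :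
    HasDerivAt (fun s => u x s)
      (fderiv ℝ (fun p : (ℝ × ℝ) × ℝ => u p.1 p.2) (x, t) (0, 1)) t := by
  have h := (ContDiff.differentiable hu (by simp) (x, t)).hasFDerivAt
  exact h.comp_hasDerivAt t ((hasDerivAt_const t x).prodMk (hasDerivAt_id t))

lemma SmoothST.continuous_deriv {u : ℝ × ℝ → ℝ → ℝ} (hu : SmoothST u) :
    Continuous fun p : (ℝ × ℝ) × ℝ => deriv (fun s => u p.1 s) p.2 := by
  simp only [(hu.hasDerivAt _ _).deriv]
  exact (ContDiff.clm_apply (ContDiff.fderiv_right (m := (⊤ : ℕ∞)) hu le_rfl)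
    contDiff_const).continuous

/-- Enstrophy balance for the vorticity equation with viscosity `ν`. -/
lemma IsNSSol.enstrophy_balance {ν T : ℝ} (hT : 0 < T) {u ψ : ℝ × ℝ → ℝ → ℝ}
    (h : IsNSSol ν T u ψ) :
    (∫ x in Q, u x T ^ 2) - ∫ x in Q, u x 0 ^ 2
      = -(2 * (ν * ∫ t in (0 : ℝ)..T, ∫ x in Q, gradSq (sl u t) x)) := by
  obtain ⟨hu, hψ, pu, pψ, heq, -⟩ := h
  have cu : Continuous fun p : (ℝ × ℝ) × ℝ => u p.1 p.2 := ContDiff.continuous hu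
  have cd := hu.continuous_deriv
  have ct : ∀ t, Continuous fun x => u x t ^ 2 := fun t =>
    (hu.contDiff_sl t).continuous.pow 2
  have cH : Continuous fun p : (ℝ × ℝ) × ℝ => 2 * (u p.1 p.2 * deriv (fun s => u p.1 s) p.2) :=
    continuous_const.mul (cu.mul cd)
  have hftc : ∀ x, u x T ^ 2 - u x 0 ^ 2
      = ∫ t in Ioc 0 T, 2 * (u x t * deriv (fun s => u x s) t) := by
    intro x
    rw [← intervalIntegral.integral_of_le hT.le]
    refine (intervalIntegral.integral_eq_sub_of_hasDerivAt (f := fun t => u x t ^ 2)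
      (fun t _ => ?_) ?_).symm
    · have hd := (hu.hasDerivAt x t).differentiableAt.hasDerivAt.pow 2
      refine hd.congr_deriv ?_
      simp
      ring
    · exact (cH.comp (Continuous.prodMk_right x)).intervalIntegrable 0 T
  rw [← integral_sub (integrableOn_Q (ct T)) (integrableOn_Q (ct 0))]
  simp only [hftc]
  rw [integral_integral_swap, ← intervalIntegral.integral_of_le hT.le,
    ← intervalIntegral.integral_const_mul, ← intervalIntegral.integral_const_mul,
    ← intervalIntegral.integral_neg]
  · refine intervalIntegral.integral_congr fun t ht => ?_
    rw [uIcc_of_le hT.le] at ht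
    have hE : ∀ x, deriv (fun s => u x s) t = ν * lap (sl u t) x - adv (sl ψ t) (sl u t) x :=
      fun x => eq_sub_of_add_eq (heq x t ht)
    have := integral_mul_rhs (hu.contDiff_sl t) (hψ.contDiff_sl t) (pu t ht) (pψ t ht) ν
    simp only [hE, integral_const_mul]
    change 2 * (∫ x in Q, sl u t x * (ν * lap (sl u t) x - adv (sl ψ t) (sl u t) x)) = _
    rw [this]
    ring
  · rw [Measure.prod_restrict]
    refine IntegrableOn.mono_set (t := Q ×ˢ Icc 0 T) ?_ (prod_mono_right Ioc_subset_Icc_self)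
    exact cH.continuousOn.integrableOn_compact (isCompact_Q.prod isCompact_Icc)

lemma IsEulerSol.isNSSol {T : ℝ} {ω ψ : ℝ × ℝ → ℝ → ℝ} (h : IsEulerSol T ω ψ) :
    IsNSSol 0 T ω ψ := by
  obtain ⟨h1, h2, h3, h4, h5, h6⟩ := h
  exact ⟨h1, h2, h3, h4, fun x t ht => by rw [h5 x t ht, zero_mul], h6⟩

/-- Cauchy–Schwarz inequality for continuous functions on the torus. -/
lemma integral_mul_le_sqrt {f g : ℝ × ℝ → ℝ} (hf : Continuous f) (hg : Continuous g) :
    ∫ x in Q, f x * g x ≤ Real.sqrt (∫ x in Q, f x ^ 2) * Real.sqrt (∫ x in Q, g x ^ 2) := by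
  have hm : ∀ {h : ℝ × ℝ → ℝ}, Continuous h →
      MemLp (fun x => |h x|) (ENNReal.ofReal 2) (volume.restrict Q) := fun {h} hh => by
    rw [ENNReal.ofReal_ofNat, memLp_two_iff_integrable_sq hh.abs.aestronglyMeasurable]
    exact integrableOn_Q (hh.abs.pow 2)
  have H := integral_mul_le_Lp_mul_Lq_of_nonneg (μ := volume.restrict Q) Real.HolderConjugate.two_two
    (Filter.Eventually.of_forall fun x => abs_nonneg (f x))
    (Filter.Eventually.of_forall fun x => abs_nonneg (g x)) (hm hf) (hm hg)
  simp only [Real.rpow_two, sq_abs, ← Real.sqrt_eq_rpow] at H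
  refine le_trans (integral_mono (integrableOn_Q (hf.mul hg))
    (integrableOn_Q (hf.abs.mul hg.abs)) fun x => ?_) H
  exact (le_abs_self _).trans (abs_mul _ _).le

/-- The enstrophy dissipation of the Navier–Stokes flow is bounded by the
inviscid-limit discrepancy at the final time:
(ν/T) ∫₀ᵀ ∫ |∇ω_ν|² dx dt ≤ (2/T) ‖φ‖_{L²} ‖ω(·,T) − ω_ν(·,T)‖_{L²}. -/
theorem enstrophy_dissipation_le_inviscid_discrepancy
    (ν T : ℝ) (hν : 0 < ν) (hT : 0 < T)
    (φ : ℝ × ℝ → ℝ) (hφ : ContDiff ℝ (⊤ : ℕ∞) φ) (hφp : Per φ)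
    (ω ψ : ℝ × ℝ → ℝ → ℝ) (hE : IsEulerSol T ω ψ) (hE0 : ∀ x, ω x 0 = φ x)
    (ων ψν : ℝ × ℝ → ℝ → ℝ) (hN : IsNSSol ν T ων ψν) (hN0 : ∀ x, ων x 0 = φ x) :
    (ν / T) * ∫ t in (0:ℝ)..T, ∫ x in Q, gradSq (sl ων t) x
      ≤ (2 / T) * Real.sqrt (∫ x in Q, (φ x) ^ 2)
          * Real.sqrt (∫ x in Q, (ω x T - ων x T) ^ 2) := by
  have bE := hE.isNSSol.enstrophy_balance hT
  have bN := hN.enstrophy_balance hT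
  simp only [hE0, zero_mul, mul_zero, neg_zero] at bE
  simp only [hN0] at bN
  have cω : Continuous fun x => ω x T := (hE.1.contDiff_sl T).continuous
  have cν : Continuous fun x => ων x T := (hN.1.contDiff_sl T).continuous
  have cd : Continuous fun x => ω x T - ων x T := cω.sub cν
  have cω2 : Continuous fun x => ω x T ^ 2 := cω.pow 2
  have cν2 : Continuous fun x => ων x T ^ 2 := cν.pow 2
  have hCS := integral_mul_le_sqrt cω cd
  have hmono : (∫ x in Q, ω x T ^ 2) - ∫ x in Q, ων x T ^ 2
      ≤ 2 * ∫ x in Q, ω x T * (ω x T - ων x T) := by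
    rw [← integral_sub (integrableOn_Q cω2) (integrableOn_Q cν2),
      ← integral_const_mul]
    refine integral_mono (integrableOn_Q (cω2.sub cν2))
      (integrableOn_Q (continuous_const.mul (cω.mul cd))) fun x => ?_
    nlinarith [sq_nonneg (ω x T - ων x T)]
  rw [sub_eq_zero.mp bE] at hCS hmono
  have hnn : 0 ≤ Real.sqrt (∫ x in Q, φ x ^ 2)
      * Real.sqrt (∫ x in Q, (ω x T - ων x T) ^ 2) := by positivity
  rw [div_mul_eq_mul_div, mul_assoc, div_mul_eq_mul_div]
  refine div_le_div_of_nonneg_right ?_ hT.le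
  linarith
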